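/- High-dimensional rate bound for CAVI in Bayesian logistic regression under the ridge prior (Corollary 3, part (i), finite-sample statement). Let X be a real n×p matrix with rows x₁,…,x_n and p ≥ 1, let c > 0, and let c₁,…,c_n > 0. Define φ(t) := tanh(t/2)/(2t) for t ≠ 0, set Q := Xᵀ diag(φ(c₁),…,φ(c_n)) X + (p/c)•1, and let A := Q^{-1/2} Xᵀ diag(φ'(c₁)²c₁²/φ(c₁), …, φ'(c_n)²c_n²/φ(c_n)) X Q^{-1/2}. Then λ_max(A) ≤ (c/p)·λ_max(XᵀX) / (4 + (c/p)·λ_max(XᵀX)), and in particular λ_max(A) < 1. -/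

import Mathlib

open Matrix

/-- `λ_max`: for a real symmetric matrix, the largest element of its (real) spectrum. -/
noncomputable def lamMax {p : ℕ} (A : Matrix (Fin p) (Fin p) ℝ) : ℝ :=
  sSup (spectrum ℝ A)

/-- The Pólya–Gamma mean function `φ(t) = tanh(t/2)/(2t)`. -/
noncomputable def pgMean (t : ℝ) : ℝ := Real.tanh (t / 2) / (2 * t)

lemma pgMean_pos {t : ℝ} (ht : 0 < t) : 0 < pgMean t := by
  unfold pgMean
  rw [Real.tanh_eq_sinh_div_cosh]
  have := Real.sinh_pos_iff.mpr (half_pos ht)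
  have := Real.cosh_pos (t / 2)
  positivity

lemma hasDerivAt_pgMean {t : ℝ} (ht : t ≠ 0) :
    HasDerivAt pgMean ((1 / (4 * Real.cosh (t / 2) ^ 2) - pgMean t) / t) t := by
  have hc := (Real.cosh_pos (t / 2)).ne'
  have hh : HasDerivAt (fun x : ℝ => x / 2) (1 / 2) t := (hasDerivAt_id t).div_const 2
  have h := (hh.sinh.div hh.cosh hc).div ((hasDerivAt_id t).const_mul 2) (by simpa using ht)
  have hfun : pgMean = fun x => Real.sinh (x / 2) / Real.cosh (x / 2) / (2 * x) := by
    ext x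
    rw [pgMean, Real.tanh_eq_sinh_div_cosh]
  rw [hfun]
  refine HasDerivAt.congr_deriv h ?_
  simp only [id, Pi.div_apply]
  field_simp
  linear_combination (4 * t) * Real.cosh_sq_sub_sinh_sq (t / 2)

lemma pgMean_le_quarter {t : ℝ} (ht : 0 < t) : pgMean t ≤ 1 / 4 := by
  have hderiv : ∀ x : ℝ, HasDerivAt (fun x => x * Real.cosh x - Real.sinh x)
      (x * Real.sinh x) x := fun x =>
    (((hasDerivAt_id x).mul (Real.hasDerivAt_cosh x)).sub (Real.hasDerivAt_sinh x)).congr_deriv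
      (by simp)
  have hmono : Monotone fun x : ℝ => x * Real.cosh x - Real.sinh x := by
    refine monotone_of_deriv_nonneg (fun x => (hderiv x).differentiableAt) fun x => ?_
    rw [(hderiv x).deriv]
    rcases le_total 0 x with hx | hx
    · exact mul_nonneg hx (Real.sinh_nonneg_iff.mpr hx)
    · exact mul_nonneg_of_nonpos_of_nonpos hx (Real.sinh_nonpos_iff.mpr hx)
  have h := hmono (half_pos ht).le
  simp only [zero_mul, Real.sinh_zero, sub_zero] at h
  have hc := Real.cosh_pos (t / 2)
  rw [pgMean, Real.tanh_eq_sinh_div_cosh, div_div, div_le_div_iff₀ (by positivity) (by norm_num)]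
  linarith

lemma deriv_pgMean_sq_mul_sq_div_le {t : ℝ} (ht : 0 < t) :
    deriv pgMean t ^ 2 * t ^ 2 / pgMean t ≤ pgMean t := by
  have hφ := pgMean_pos ht
  have hc := Real.cosh_pos (t / 2)
  have hsech : 1 / (4 * Real.cosh (t / 2) ^ 2) ≤ 2 * pgMean t := by
    have hsinh := Real.self_le_sinh_iff.mpr ht.le
    rw [show t = 2 * (t / 2) by ring, Real.sinh_two_mul] at hsinh
    rw [pgMean, Real.tanh_eq_sinh_div_cosh, div_div, mul_div_assoc',
      div_le_div_iff₀ (by positivity) (by positivity)]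
    nlinarith [mul_le_mul_of_nonneg_left hsinh hc.le,
      mul_pos hc (mul_pos (Real.sinh_pos_iff.mpr (half_pos ht)) hc)]
  have hpos : 0 ≤ 1 / (4 * Real.cosh (t / 2) ^ 2) := by positivity
  rw [(hasDerivAt_pgMean ht.ne').deriv, div_pow, div_mul_cancel₀ _ (by positivity),
    div_le_iff₀ hφ]
  nlinarith

lemma le_lamMax_of_mem {p : ℕ} {A : Matrix (Fin p) (Fin p) ℝ} {μ : ℝ} (h : μ ∈ spectrum ℝ A) :
    μ ≤ lamMax A :=
  le_csSup A.finite_real_spectrum.bddAbove h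

lemma Matrix.IsHermitian.dotProduct_mulVec_le_lamMax {p : ℕ} {A : Matrix (Fin p) (Fin p) ℝ}
    (hA : A.IsHermitian) (w : Fin p → ℝ) : w ⬝ᵥ (A *ᵥ w) ≤ lamMax A * (w ⬝ᵥ w) := by
  have hB : (algebraMap ℝ (Matrix (Fin p) (Fin p) ℝ) (lamMax A) - A).IsHermitian := by
    refine IsHermitian.sub ?_ hA
    rw [Algebra.algebraMap_eq_smul_one]
    simp [IsHermitian]
  have hpsd := hB.posSemidef_iff_eigenvalues_nonneg.mpr fun i => by
    have hi := hB.eigenvalues_mem_spectrum_real i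
    rw [← spectrum.singleton_sub_eq, Set.singleton_sub] at hi
    obtain ⟨μ, hμ, h⟩ := hi
    rw [← h]
    exact sub_nonneg.mpr (le_lamMax_of_mem hμ)
  have h := hpsd.dotProduct_mulVec_nonneg w
  simp only [star_trivial, Algebra.algebraMap_eq_smul_one, sub_mulVec, smul_mulVec, one_mulVec,
    dotProduct_sub, dotProduct_smul, smul_eq_mul] at h
  linarith

lemma Matrix.PosSemidef.lamMax_nonneg {p : ℕ} {A : Matrix (Fin p) (Fin p) ℝ}
    (hA : A.PosSemidef) : 0 ≤ lamMax A := by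
  refine Real.sSup_nonneg fun μ hμ => ?_
  rw [hA.isHermitian.spectrum_real_eq_range_eigenvalues] at hμ
  obtain ⟨i, rfl⟩ := hμ
  exact hA.eigenvalues_nonneg i

lemma dotProduct_transpose_mul_diagonal_mul_mulVec {n p : ℕ} (X : Matrix (Fin n) (Fin p) ℝ)
    (d : Fin n → ℝ) (w : Fin p → ℝ) :
    w ⬝ᵥ ((Xᵀ * diagonal d * X) *ᵥ w) = ∑ i, d i * (X *ᵥ w) i ^ 2 := by
  rw [← mulVec_mulVec, ← mulVec_mulVec, dotProduct_mulVec, vecMul_transpose, dotProduct]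
  refine Finset.sum_congr rfl fun i _ => ?_
  rw [mulVec_diagonal]
  ring

lemma exists_of_mem_spectrum_inv_mul_mul_inv {p : ℕ} {S M : Matrix (Fin p) (Fin p) ℝ}
    (hS : S.PosDef) {μ : ℝ} (hμ : μ ∈ spectrum ℝ (S⁻¹ * M * S⁻¹)) :
    ∃ w : Fin p → ℝ, 0 < w ⬝ᵥ ((S * S) *ᵥ w) ∧
      w ⬝ᵥ (M *ᵥ w) = μ * (w ⬝ᵥ ((S * S) *ᵥ w)) := by
  have hSt : Sᵀ = S := by simpa using hS.isHermitian.eq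
  have hdet : IsUnit S.det := hS.det_pos.ne'.isUnit
  rw [← spectrum_toLin', ← Module.End.hasEigenvalue_iff_mem_spectrum] at hμ
  obtain ⟨v, hv, hv0⟩ := hμ.exists_hasEigenvector
  rw [Module.End.mem_eigenspace_iff, toLin'_apply] at hv
  have hSw : S *ᵥ (S⁻¹ *ᵥ v) = v := by rw [mulVec_mulVec, mul_nonsing_inv _ hdet, one_mulVec]
  have hq : (S⁻¹ *ᵥ v) ⬝ᵥ ((S * S) *ᵥ (S⁻¹ *ᵥ v)) = v ⬝ᵥ v := by
    rw [← mulVec_mulVec, dotProduct_mulVec, ← mulVec_transpose, hSt, hSw]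
  refine ⟨S⁻¹ *ᵥ v, ?_, ?_⟩
  · rw [hq]
    simpa using dotProduct_star_self_pos_iff.mpr hv0
  · have hv' : S⁻¹ *ᵥ (M *ᵥ (S⁻¹ *ᵥ v)) = μ • v := by
      rw [← hv, mulVec_mulVec, mulVec_mulVec, Matrix.mul_assoc]
    rw [hq, ← smul_eq_mul, ← dotProduct_smul, ← hv', dotProduct_mulVec v, ← mulVec_transpose,
      transpose_nonsing_inv, hSt]

/-- High-dimensional rate bound for CAVI in Bayesian logistic regression under the ridge
prior `Q₀ = (p/c) • 1` (Corollary 3, part (i), finite-sample statement).  Here `S` is the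
unique symmetric positive definite square root of `Q`, so that `S⁻¹ = Q^{-1/2}`. -/
theorem logit_ridge_prior_rate {n p : ℕ} (hp : 1 ≤ p)
    (X : Matrix (Fin n) (Fin p) ℝ) (c : ℝ) (hc : 0 < c)
    (cs : Fin n → ℝ) (hcs : ∀ i, 0 < cs i)
    (S : Matrix (Fin p) (Fin p) ℝ) (hS : S.PosDef)
    (hSsq : S * S = Xᵀ * Matrix.diagonal (fun i => pgMean (cs i)) * X
      + ((p : ℝ) / c) • (1 : Matrix (Fin p) (Fin p) ℝ)) :
    lamMax (S⁻¹ * (Xᵀ * Matrix.diagonal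
        (fun i => (deriv pgMean (cs i)) ^ 2 * (cs i) ^ 2 / pgMean (cs i)) * X) * S⁻¹)
      ≤ (c / p) * lamMax (Xᵀ * X) / (4 + (c / p) * lamMax (Xᵀ * X)) ∧
    lamMax (S⁻¹ * (Xᵀ * Matrix.diagonal
        (fun i => (deriv pgMean (cs i)) ^ 2 * (cs i) ^ 2 / pgMean (cs i)) * X) * S⁻¹) < 1 := by
  have hp' : (0 : ℝ) < p := by exact_mod_cast hp
  have hk : 0 < c / p := div_pos hc hp'
  have hpsd : (Xᵀ * X).PosSemidef := by
    simpa using posSemidef_conjTranspose_mul_self X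
  set L := lamMax (Xᵀ * X)
  have hx : 0 ≤ c / p * L := mul_nonneg hk.le hpsd.lamMax_nonneg
  have hle : lamMax (S⁻¹ * (Xᵀ * Matrix.diagonal
      (fun i => (deriv pgMean (cs i)) ^ 2 * (cs i) ^ 2 / pgMean (cs i)) * X) * S⁻¹)
      ≤ (c / p) * L / (4 + (c / p) * L) := by
    refine Real.sSup_le (fun μ hμ => ?_) (by positivity)
    obtain ⟨w, hpos, heq⟩ := exists_of_mem_spectrum_inv_mul_mul_inv hS hμ
    have hray : ∑ i, (X *ᵥ w) i ^ 2 ≤ L * (w ⬝ᵥ w) := by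
      have h := hpsd.isHermitian.dotProduct_mulVec_le_lamMax w
      have h1 := dotProduct_transpose_mul_diagonal_mul_mulVec X (fun _ => 1) w
      simp only [diagonal_one, Matrix.mul_one, one_mul] at h1
      rwa [h1] at h
    have hQ : w ⬝ᵥ ((S * S) *ᵥ w)
        = ∑ i, pgMean (cs i) * (X *ᵥ w) i ^ 2 + p / c * (w ⬝ᵥ w) := by
      rw [hSsq, add_mulVec, dotProduct_add, dotProduct_transpose_mul_diagonal_mul_mulVec,
        smul_mulVec, one_mulVec, dotProduct_smul, smul_eq_mul]
    rw [dotProduct_transpose_mul_diagonal_mul_mulVec] at heq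
    have hsum : (4 + c / p * L) *
        ∑ i, deriv pgMean (cs i) ^ 2 * cs i ^ 2 / pgMean (cs i) * (X *ᵥ w) i ^ 2
        ≤ c / p * L * ∑ i, pgMean (cs i) * (X *ᵥ w) i ^ 2 + ∑ i, (X *ᵥ w) i ^ 2 := by
      rw [Finset.mul_sum, Finset.mul_sum, ← Finset.sum_add_distrib]
      refine Finset.sum_le_sum fun i _ => ?_
      have h1 := mul_le_mul_of_nonneg_left (deriv_pgMean_sq_mul_sq_div_le (hcs i))
        (by positivity : 0 ≤ 4 + c / p * L)
      have h2 := pgMean_le_quarter (hcs i)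
      calc _ = (4 + c / p * L) * (deriv pgMean (cs i) ^ 2 * cs i ^ 2 / pgMean (cs i))
            * (X *ᵥ w) i ^ 2 := by ring
        _ ≤ (c / p * L * pgMean (cs i) + 1) * (X *ᵥ w) i ^ 2 :=
            mul_le_mul_of_nonneg_right (by linarith) (sq_nonneg _)
        _ = _ := by ring
    have hprior : c / p * L * (p / c * (w ⬝ᵥ w)) = L * (w ⬝ᵥ w) := by field_simp
    rw [le_div_iff₀ (by positivity)]
    refine le_of_mul_le_mul_right ?_ hpos
    rw [heq] at hsum
    calc _ = (4 + c / p * L) * (μ * (w ⬝ᵥ ((S * S) *ᵥ w))) := by ring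
      _ ≤ _ := hsum
      _ ≤ _ := by rw [hQ, mul_add, hprior]; linarith
  refine ⟨hle, hle.trans_lt ?_⟩
  rw [div_lt_one (by positivity)]
  linarith
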